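/- Let X be a path-connected space in which the graph G_α = {(x,t) ∈ X × I : α(t) = x} of every path α ∈ P(X,x₀) is closed (e.g. X Hausdorff), and let H ≤ π₁(X,x₀) be a subgroup such that the coset space π₁(X,x₀)/H (with quotient topology from the compact-open topology on the loop space) is totally path-disconnected. Then the endpoint projection p_H : X̃_H → X has the continuous path-covering property and (p_H)_#(π₁(X̃_H, x̃_H)) = H. -/

import Mathlib

open unitInterval Topology

/-- The space of paths in `X` starting at `x`, as a subspace of `C(I, X)`
with the compact-open topology. -/
abbrev PS (X : Type*) [TopologicalSpace X] (x : X) : Type _ := {f : C(I, X) // f 0 = x}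

/-- The map on based path spaces induced by `p`. -/
def indMap {E X : Type*} [TopologicalSpace E] [TopologicalSpace X] (p : C(E, X)) (e : E) :
    PS E e → PS X (p e) :=
  fun α => ⟨p.comp α.1, by simp [α.2]⟩

/-- `p` has the unique path-lifting property. -/
def UniquePathLifting {E X : Type*} [TopologicalSpace E] [TopologicalSpace X]
    (p : C(E, X)) : Prop :=
  ∀ e : E, Function.Injective (indMap p e)

/-- `p` has the path-covering property. -/
def PathCovering {E X : Type*} [TopologicalSpace E] [TopologicalSpace X]
    (p : C(E, X)) : Prop :=
  ∀ e : E, Function.Bijective (indMap p e)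

/-- `p` has the continuous path-covering property. -/
def ContPathCovering {E X : Type*} [TopologicalSpace E] [TopologicalSpace X]
    (p : C(E, X)) : Prop :=
  ∀ e : E, IsHomeomorph (indMap p e)

/-- A space is totally path-disconnected if every path in it is constant. -/
def TotallyPathDisconnected (Z : Type*) [TopologicalSpace Z] : Prop :=
  ∀ γ : C(I, Z), ∀ s t : I, γ s = γ t

/-- `p` has the homotopy lifting property with respect to `Z`. -/
def HLP {E X : Type*} [TopologicalSpace E] [TopologicalSpace X] (p : C(E, X))
    (Z : Type*) [TopologicalSpace Z] : Prop :=
  ∀ (f : C(Z, E)) (g : C(Z × I, X)), (∀ z, g (z, 0) = p (f z)) →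
    ∃ G : C(Z × I, E), (∀ w, p (G w) = g w) ∧ ∀ z, G (z, 0) = f z
attribute [local instance] Path.Homotopic.setoid

/-- The homotopy class of a loop, as an element of the fundamental group. -/
noncomputable def loopCls {X : Type u} [TopologicalSpace X] {x₀ : X} (γ : Path x₀ x₀) :
    FundamentalGroup X x₀ :=
  FundamentalGroup.fromPath (X := TopCat.of X) ⟦γ⟧

/-- The relation on `P(X,x₀)` defining `X̃_H`: `α ∼ β` iff `α(1) = β(1)` and
`[α·β⁻] ∈ H`. -/
def pathRel {X : Type u} [TopologicalSpace X] (x₀ : X)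
    (H : Subgroup (FundamentalGroup X x₀)) (α β : PS X x₀) : Prop :=
  ∃ h : α.1 1 = β.1 1,
    loopCls ((⟨α.1, α.2, rfl⟩ : Path x₀ (α.1 1)).trans
      ((⟨β.1, β.2, h.symm⟩ : Path x₀ (α.1 1)).symm)) ∈ H

/-- The space `X̃_H`, the quotient of `P(X,x₀)` by `pathRel`. -/
abbrev XH {X : Type u} [TopologicalSpace X] (x₀ : X)
    (H : Subgroup (FundamentalGroup X x₀)) : Type u :=
  Quot (pathRel x₀ H)

/-- The basepoint `x̃_H` of `X̃_H`: the class of the constant path. -/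
def baseptH {X : Type u} [TopologicalSpace X] (x₀ : X)
    (H : Subgroup (FundamentalGroup X x₀)) : XH x₀ H :=
  Quot.mk _ ⟨ContinuousMap.const I x₀, rfl⟩

/-- The endpoint projection `p_H : X̃_H → X`. -/
def pH {X : Type u} [TopologicalSpace X] (x₀ : X)
    (H : Subgroup (FundamentalGroup X x₀)) : C(XH x₀ H, X) where
  toFun := Quot.lift (fun α : PS X x₀ => α.1 1) (fun _ _ h => h.elim fun h' _ => h')
  continuous_toFun := continuous_quot_lift _
    ((ContinuousEvalConst.continuous_eval_const (1 : I)).comp continuous_subtype_val)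

/-- The product of a quotient map with the identity of a locally compact space is a quotient map. -/
theorem Topology.IsQuotientMap.prodMap_id {A B Y : Type*} [TopologicalSpace A] [TopologicalSpace B]
    [TopologicalSpace Y] [LocallyCompactSpace Y] {f : A → B} (hf : IsQuotientMap f) :
    IsQuotientMap (Prod.map f (id : Y → Y)) := by
  rw [isQuotientMap_iff_isClosed]
  refine ⟨hf.surjective.prodMap Function.surjective_id, fun s =>
    ⟨fun hs => hs.preimage (hf.continuous.prodMap continuous_id), fun hs => ?_⟩⟩
  exact isOpen_compl_iff.1 (continuous_Prop.1 (hf.continuous_lift_prod_left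
    (g := fun w => w ∈ sᶜ) (continuous_Prop.2 hs.isOpen_compl)))

/-- A quotient map restricts to a quotient map over every closed subset of the target. -/
theorem Topology.IsQuotientMap.restrictPreimage_isClosed {A B : Type*} [TopologicalSpace A]
    [TopologicalSpace B] {f : A → B} (hf : IsQuotientMap f) {s : Set B} (hs : IsClosed s) :
    IsQuotientMap (s.restrictPreimage f) := by
  rw [isQuotientMap_iff_isClosed]
  refine ⟨hf.surjective.restrictPreimage s, fun t =>
    ⟨fun ht => ht.preimage hf.continuous.restrictPreimage, fun ht => ?_⟩⟩
  rw [hs.isClosedEmbedding_subtypeVal.isClosed_iff_image_isClosed,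
    (isQuotientMap_iff_isClosed.1 hf).2]
  convert! (hs.preimage hf.continuous).isClosedEmbedding_subtypeVal.isClosedMap _ ht using 1
  ext a
  simp only [Set.mem_preimage, Set.mem_image, Subtype.exists, exists_and_right, exists_eq_right]
  rfl

section CosetRel

variable {X : Type u} [TopologicalSpace X] {x₀ : X}

theorem loopCls_eq_mk (p : Path x₀ x₀) : loopCls p = Path.Homotopic.Quotient.mk p := rfl

theorem loopCls_trans (p q : Path x₀ x₀) : loopCls (p.trans q) = loopCls q * loopCls p := rfl

theorem loopCls_symm (p : Path x₀ x₀) : loopCls p.symm = (loopCls p)⁻¹ := rfl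

theorem loopCls_congr {p q : Path x₀ x₀} (h : p.Homotopic q) : loopCls p = loopCls q :=
  Path.Homotopic.Quotient.eq.2 h

theorem loopCls_trans_symm_self {y : X} (p : Path x₀ y) : loopCls (p.trans p.symm) = 1 := by
  simpa [loopCls_eq_mk] using FundamentalGroup.one_def.symm

variable (H : Subgroup (FundamentalGroup X x₀))

/-- Two paths `p, q` with the same endpoints are related if `[p·q⁻] ∈ H`. -/
def CosetRel {y : X} (p q : Path x₀ y) : Prop := loopCls (p.trans q.symm) ∈ H

variable {H} {y : X} {p q r : Path x₀ y}

theorem CosetRel.refl (p : Path x₀ y) : CosetRel H p p := by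
  unfold CosetRel
  rw [loopCls_trans_symm_self]
  exact H.one_mem

theorem CosetRel.symm (h : CosetRel H p q) : CosetRel H q p := by
  have : loopCls (q.trans p.symm) = (loopCls (p.trans q.symm))⁻¹ := by
    rw [← loopCls_symm, Path.trans_symm, Path.symm_symm]
  unfold CosetRel
  rw [this]
  exact H.inv_mem h

theorem CosetRel.trans (h : CosetRel H p q) (h' : CosetRel H q r) : CosetRel H p r := by
  have : loopCls (p.trans r.symm) = loopCls (q.trans r.symm) * loopCls (p.trans q.symm) := by
    rw [← loopCls_trans]
    simp only [loopCls_eq_mk, Path.Homotopic.Quotient.mk_trans, Path.Homotopic.Quotient.mk_symm,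
      Path.Homotopic.Quotient.trans_assoc]
    rw [← Path.Homotopic.Quotient.trans_assoc _ _ (Path.Homotopic.Quotient.symm _)]
    simp
  unfold CosetRel
  rw [this]
  exact H.mul_mem h' h

theorem cosetRel_trans_symm_iff :
    CosetRel H (p.trans r.symm) (q.trans r.symm) ↔ CosetRel H p q := by
  have : loopCls ((p.trans r.symm).trans (q.trans r.symm).symm) = loopCls (p.trans q.symm) := by
    rw [Path.trans_symm, Path.symm_symm]
    simp only [loopCls_eq_mk, Path.Homotopic.Quotient.mk_trans, Path.Homotopic.Quotient.mk_symm,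
      Path.Homotopic.Quotient.trans_assoc]
    rw [← Path.Homotopic.Quotient.trans_assoc (Path.Homotopic.Quotient.symm _)]
    simp
  unfold CosetRel
  rw [this]

theorem cosetRel_refl_right_iff {p : Path x₀ x₀} :
    CosetRel H p (Path.refl x₀) ↔ loopCls p ∈ H := by
  have : loopCls (p.trans (Path.refl x₀).symm) = loopCls p := by
    simp [loopCls_eq_mk]
  unfold CosetRel
  rw [this]

variable (H) in
theorem cosetRel_equivalence : Equivalence (CosetRel H (y := y)) :=
  ⟨CosetRel.refl, CosetRel.symm, CosetRel.trans⟩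

/-- An element of the based path space as a `Path` to a prescribed endpoint. -/
def PS.toPath (α : PS X x₀) (h : α.1 1 = y) : Path x₀ y := ⟨α.1, α.2, h⟩

theorem PS.toPath_trans_symm_congr {z : X} {α β : PS X x₀} (hα : α.1 1 = y) (hβ : β.1 1 = y)
    (hα' : α.1 1 = z) (hβ' : β.1 1 = z) :
    (PS.toPath α hα).trans (PS.toPath β hβ).symm =
      (PS.toPath α hα').trans (PS.toPath β hβ').symm := by
  subst hα hα'
  rfl

theorem pathRel_iff {α β : PS X x₀} (hα : α.1 1 = y) (hβ : β.1 1 = y) :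
    pathRel x₀ H α β ↔ CosetRel H (PS.toPath α hα) (PS.toPath β hβ) := by
  subst hα
  exact ⟨fun h => h.elim fun _ h => h, fun h => ⟨hβ.symm, h⟩⟩

theorem pathRel_equivalence (H : Subgroup (FundamentalGroup X x₀)) :
    Equivalence (pathRel x₀ H) where
  refl _ := (pathRel_iff rfl rfl).2 (CosetRel.refl _)
  symm h := (pathRel_iff h.1.symm rfl).2 ((pathRel_iff rfl h.1.symm).1 h).symm
  trans h h' := (pathRel_iff rfl (h.1.trans h'.1).symm).2
    (((pathRel_iff rfl h.1.symm).1 h).trans ((pathRel_iff h.1.symm (h.1.trans h'.1).symm).1 h'))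

theorem quot_mk_eq_iff_of_equivalence {A : Type*} {R : A → A → Prop} (hR : Equivalence R)
    {a b : A} : Quot.mk R a = Quot.mk R b ↔ R a b :=
  ⟨fun h => (hR.eqvGen_iff).1 (Quot.eqvGen_exact h), Quot.sound⟩

end CosetRel

section Lift

variable {X : Type u} [TopologicalSpace X] {x₀ : X}

/-- The initial segment `u ↦ c (s u)` of a path `c`. -/
def PS.initSeg (c : PS X x₀) (s : I) : PS X x₀ :=
  ⟨c.1.comp ⟨fun u => s * u, by fun_prop⟩, by simp [c.2]⟩

@[simp]
theorem PS.initSeg_apply (c : PS X x₀) (s u : I) : (c.initSeg s).1 u = c.1 (s * u) := rfl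

theorem PS.initSeg_one (c : PS X x₀) : c.initSeg 1 = c := by
  ext u
  simp

theorem PS.initSeg_zero (c : PS X x₀) : c.initSeg 0 = ⟨ContinuousMap.const I x₀, rfl⟩ := by
  ext u
  simp [c.2]

theorem PS.continuous_initSeg (c : PS X x₀) : Continuous c.initSeg := by
  refine Continuous.subtype_mk (ContinuousMap.continuous_of_continuous_uncurry _ ?_) _
  exact c.1.continuous.comp (by fun_prop : Continuous fun w : I × I => w.1 * w.2)

variable {H : Subgroup (FundamentalGroup X x₀)}

/-- The loop space relation whose quotient is the coset space `π₁(X,x₀)/H`. -/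
abbrev loopRel (H : Subgroup (FundamentalGroup X x₀))
    (α β : {f : C(I, X) // f 0 = x₀ ∧ f 1 = x₀}) : Prop :=
  loopCls ((⟨α.1, α.2.1, α.2.2⟩ : Path x₀ x₀).trans
    (⟨β.1, β.2.1, β.2.2⟩ : Path x₀ x₀).symm) ∈ H

theorem loopRel_equivalence (H : Subgroup (FundamentalGroup X x₀)) : Equivalence (loopRel H) where
  refl _ := CosetRel.refl _
  symm h := CosetRel.symm h
  trans h h' := CosetRel.trans h h'

/-- A path in `X̃_H` lying over a reparametrization `c ∘ s` of a path `c` from `x₀` and meeting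
the standard lift of `c ∘ s` once agrees with it. -/
theorem eq_mk_initSeg
    (hgraph : ∀ α : PS X x₀, IsClosed {q : X × I | α.1 q.2 = q.1})
    (htpd : TotallyPathDisconnected (Quot (loopRel H)))
    (c : PS X x₀) (s : C(I, I)) (γ : C(I, XH x₀ H))
    (hγ : ∀ t, pH x₀ H (γ t) = c.1 (s t)) {t₀ : I}
    (h₀ : γ t₀ = Quot.mk _ (c.initSeg (s t₀))) (t : I) :
    γ t = Quot.mk _ (c.initSeg (s t)) := by
  let A : Set (XH x₀ H × I) := {w | c.1 (s w.2) = pH x₀ H w.1}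
  have hA : IsClosed A :=
    (hgraph c).preimage (f := fun w : XH x₀ H × I => (pH x₀ H w.1, s w.2)) (by fun_prop)
  let Q : PS X x₀ × I → XH x₀ H × I := Prod.map (Quot.mk _) id
  have hQ : IsQuotientMap (A.restrictPreimage Q) :=
    (isQuotientMap_quot_mk.prodMap_id).restrictPreimage_isClosed hA
  have hc : ∀ w : Q ⁻¹' A, (c.initSeg (s w.1.2)).1 1 = w.1.1.1 1 := fun w => by
    rw [PS.initSeg_apply, mul_one]
    exact w.2
  let ℓ : ∀ w : Q ⁻¹' A, Path x₀ x₀ := fun w =>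
    (PS.toPath w.1.1 rfl).trans (PS.toPath (c.initSeg (s w.1.2)) (hc w)).symm
  have hℓ : Continuous fun v : (Q ⁻¹' A) × I => ℓ v.1 v.2 := by
    refine Path.trans_continuous_family (fun w : Q ⁻¹' A => PS.toPath w.1.1 rfl) ?_
      (fun w : Q ⁻¹' A => (PS.toPath (c.initSeg (s w.1.2)) (hc w)).symm)
      (Path.symm_continuous_family _ ?_)
    · exact (by fun_prop : Continuous fun v : (Q ⁻¹' A) × I => v.1.1.1.1 v.2)
    · exact (by fun_prop : Continuous fun v : (Q ⁻¹' A) × I => c.1 (s v.1.1.2 * v.2))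
  let F : C(Q ⁻¹' A, Quot (loopRel H)) :=
    ⟨fun w => Quot.mk _ ⟨(ℓ w).toContinuousMap, (ℓ w).source, (ℓ w).target⟩,
      continuous_quot_mk.comp
        ((ContinuousMap.continuous_of_continuous_uncurry _ hℓ).subtype_mk _)⟩
  have hF : Function.FactorsThrough F (A.restrictPreimage Q) := by
    rintro ⟨⟨α, a⟩, hα⟩ ⟨⟨β, b⟩, hβ⟩ h
    obtain ⟨hαβ, hab⟩ := Prod.ext_iff.1 (Subtype.ext_iff.1 h)
    obtain rfl : a = b := hab
    have hr := (quot_mk_eq_iff_of_equivalence (pathRel_equivalence H)).1 hαβ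
    refine Quot.sound ?_
    have h1 : β.1 1 = (c.initSeg (s a)).1 1 := (hc ⟨(β, a), hβ⟩).symm
    have h2 : α.1 1 = (c.initSeg (s a)).1 1 := (hc ⟨(α, a), hα⟩).symm
    change CosetRel H (ℓ _) (ℓ _)
    rw [show ℓ ⟨(α, a), hα⟩ = (PS.toPath α h2).trans (PS.toPath (c.initSeg (s a)) rfl).symm from
        PS.toPath_trans_symm_congr .., show ℓ ⟨(β, a), hβ⟩ =
        (PS.toPath β h1).trans (PS.toPath (c.initSeg (s a)) rfl).symm from
        PS.toPath_trans_symm_congr .., cosetRel_trans_symm_iff]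
    exact (pathRel_iff h2 h1).1 hr
  let T := IsQuotientMap.lift (f := ⟨_, hQ.continuous⟩) hQ F hF
  have hT : ∀ w, T (A.restrictPreimage Q w) = F w := fun w =>
    DFunLike.congr_fun (IsQuotientMap.lift_comp (f := ⟨_, hQ.continuous⟩) hQ F hF) w
  have hconst := htpd (T.comp ⟨fun t => ⟨(γ t, t), (hγ t).symm⟩, by fun_prop⟩) t t₀
  obtain ⟨α, hα⟩ := Quot.exists_rep (γ t)
  have hw : c.1 (s t) = α.1 1 := by
    rw [← hγ t, ← hα]; rfl
  have hw₀ : c.1 (s t₀) = (c.initSeg (s t₀)).1 1 := by simp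
  have e : T ⟨(γ t, t), (hγ t).symm⟩ = F ⟨(α, t), hw⟩ := by
    rw [← hT]
    congr 1
    exact Subtype.ext (Prod.ext hα.symm rfl)
  have e₀ : T ⟨(γ t₀, t₀), (hγ t₀).symm⟩ = F ⟨(c.initSeg (s t₀), t₀), hw₀⟩ := by
    rw [← hT]
    congr 1
    exact Subtype.ext (Prod.ext h₀ rfl)
  have hrel := (quot_mk_eq_iff_of_equivalence (loopRel_equivalence H)).1
    (e.symm.trans (hconst.trans e₀))
  rw [← hα]
  refine Quot.sound ((pathRel_iff rfl (hc ⟨(α, t), hw⟩)).2 ?_)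
  have h1 : loopCls (ℓ ⟨(c.initSeg (s t₀), t₀), hw₀⟩) ∈ H := CosetRel.refl _
  have h2 := CosetRel.trans (H := H) (p := ℓ ⟨(α, t), hw⟩) hrel
    (cosetRel_refl_right_iff.2 h1)
  exact cosetRel_refl_right_iff.1 h2

/-- The concatenation of based paths `α` and `β`, where `β` starts at the endpoint of `α`. -/
noncomputable def PS.concat (α : PS X x₀) (β : PS X (α.1 1)) : PS X x₀ :=
  ⟨((PS.toPath α rfl).trans (PS.toPath β rfl)).toContinuousMap, Path.source _⟩

theorem PS.continuous_concat (α : PS X x₀) : Continuous α.concat := by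
  refine Continuous.subtype_mk (ContinuousMap.continuous_of_continuous_uncurry _ ?_) _
  refine Path.trans_continuous_family (fun _ : PS X (α.1 1) => PS.toPath α rfl) ?_
    (fun β : PS X (α.1 1) => PS.toPath β rfl) ?_
  · exact (by fun_prop : Continuous fun v : PS X (α.1 1) × I => α.1 v.2)
  · exact (by fun_prop : Continuous fun v : PS X (α.1 1) × I => v.1.1 v.2)

/-- The map `t ↦ (1 + t) / 2` of the unit interval to itself. -/
noncomputable def upperHalf : C(I, I) where
  toFun t := ⟨(1 + t) / 2, by constructor <;> linarith [t.2.1, t.2.2]⟩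
  continuous_toFun := by fun_prop

theorem coe_upperHalf (t : I) : (upperHalf t : ℝ) = (1 + t) / 2 := rfl

theorem PS.concat_upperHalf (α : PS X x₀) (β : PS X (α.1 1)) (t : I) :
    (α.concat β).1 (upperHalf t) = β.1 t := by
  change (PS.toPath α rfl).trans (PS.toPath β rfl) (upperHalf t) = _
  rw [Path.trans_apply]
  split_ifs with h
  · obtain rfl : t = 0 := by
      rw [coe_upperHalf] at h
      exact Subtype.ext (le_antisymm (by simpa using by linarith) t.2.1)
    refine Eq.trans ?_ β.2.symm
    change α.1 _ = α.1 1
    congr 1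
    exact Subtype.ext (by simp [coe_upperHalf])
  · change β.1 _ = β.1 t
    congr 1
    exact Subtype.ext (by simp [coe_upperHalf]; ring)

theorem PS.initSeg_concat_upperHalf_zero (α : PS X x₀) (β : PS X (α.1 1)) :
    (α.concat β).initSeg (upperHalf 0) = α := by
  ext u
  change (PS.toPath α rfl).trans (PS.toPath β rfl) (upperHalf 0 * u) = _
  rw [Path.trans_apply, dif_pos (by simpa [coe_upperHalf] using u.2.2)]
  change α.1 _ = α.1 u
  congr 1
  exact Subtype.ext (by simp [coe_upperHalf])

/-- The lift of a based path of `X` to `X̃_H` through initial segments. -/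
noncomputable def PS.lift (H : Subgroup (FundamentalGroup X x₀)) (α : PS X x₀)
    (β : PS X (α.1 1)) : PS (XH x₀ H) (Quot.mk _ α) :=
  ⟨⟨fun t => Quot.mk _ ((α.concat β).initSeg (upperHalf t)),
    continuous_quot_mk.comp ((PS.continuous_initSeg _).comp upperHalf.continuous)⟩,
    congr_arg _ (PS.initSeg_concat_upperHalf_zero α β)⟩

theorem PS.continuous_lift (α : PS X x₀) : Continuous (α.lift H) := by
  refine Continuous.subtype_mk (ContinuousMap.continuous_of_continuous_uncurry _ ?_) _
  refine continuous_quot_mk.comp (Continuous.subtype_mk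
    (ContinuousMap.continuous_of_continuous_uncurry _ ?_) _)
  exact (continuous_subtype_val.comp (α.continuous_concat.comp
    (continuous_fst.comp continuous_fst))).eval
    (by fun_prop : Continuous fun v : (PS X (α.1 1) × I) × I => upperHalf v.1.2 * v.2)

theorem continuous_indMap {E B : Type*} [TopologicalSpace E] [TopologicalSpace B] (p : C(E, B))
    (e : E) : Continuous (indMap p e) :=
  ((ContinuousMap.continuous_postcomp p).comp continuous_subtype_val).subtype_mk _

theorem contPathCovering_pH
    (hgraph : ∀ α : PS X x₀, IsClosed {q : X × I | α.1 q.2 = q.1})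
    (htpd : TotallyPathDisconnected (Quot (loopRel H))) : ContPathCovering (pH x₀ H) := by
  rintro ⟨α⟩
  refine isHomeomorph_iff_exists_inverse.2
    ⟨continuous_indMap _ _, α.lift H, fun γ => ?_, fun β => ?_, α.continuous_lift⟩
  · ext t
    refine (eq_mk_initSeg hgraph htpd _ upperHalf γ.1 (fun t => ?_) (t₀ := 0) ?_ t).symm
    · exact (PS.concat_upperHalf α (indMap (pH x₀ H) _ γ) t).symm
    · exact γ.2.trans (congr_arg _ (PS.initSeg_concat_upperHalf_zero α _).symm)
  · ext t
    change ((α.concat β).initSeg (upperHalf t)).1 1 = β.1 t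
    rw [PS.initSeg_apply, mul_one]
    exact PS.concat_upperHalf α β t

theorem mk_eq_baseptH_iff (α : Path x₀ x₀) :
    Quot.mk (pathRel x₀ H) ⟨α.toContinuousMap, α.source⟩ = baseptH x₀ H ↔ loopCls α ∈ H :=
  (quot_mk_eq_iff_of_equivalence (pathRel_equivalence H)).trans
    ((pathRel_iff α.target rfl).trans cosetRel_refl_right_iff)

theorem loopCls_mem_iff_exists_loop
    (hgraph : ∀ α : PS X x₀, IsClosed {q : X × I | α.1 q.2 = q.1})
    (htpd : TotallyPathDisconnected (Quot (loopRel H))) (α : Path x₀ x₀) :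
    loopCls α ∈ H ↔ ∃ γ : Path (baseptH x₀ H) (baseptH x₀ H),
      (γ.map (pH x₀ H).continuous).Homotopic α := by
  constructor
  · intro h
    let c : PS X x₀ := ⟨α.toContinuousMap, α.source⟩
    refine ⟨⟨⟨fun t => Quot.mk _ (c.initSeg t), continuous_quot_mk.comp c.continuous_initSeg⟩,
      congr_arg _ c.initSeg_zero,
      (congr_arg _ c.initSeg_one).trans ((mk_eq_baseptH_iff α).2 h)⟩, ?_⟩
    refine ⟨(Path.Homotopy.refl α).cast ?_ rfl⟩
    ext t
    exact (congr_arg α (mul_one t)).symm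
  · rintro ⟨γ, hγ⟩
    refine (loopCls_congr (x₀ := x₀) hγ : _ = loopCls α) ▸ (mk_eq_baseptH_iff _).1 ?_
    let c : PS X x₀ := ⟨(γ.map (pH x₀ H).continuous).toContinuousMap, Path.source _⟩
    have := eq_mk_initSeg hgraph htpd c (.id I) γ.toContinuousMap (fun _ => rfl) (t₀ := 0)
      (γ.source.trans (congr_arg _ c.initSeg_zero.symm)) 1
    exact (this.trans (congr_arg _ c.initSeg_one)).symm.trans γ.target

end Lift

/-- If every path in `X` has closed graph and the coset space `π₁(X,x₀)/H`
(realized as the quotient of the loop space by the coset relation) is totally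
path-disconnected, then the endpoint projection `p_H : X̃_H → X` has the
continuous path-covering property and `(p_H)_#(π₁(X̃_H, x̃_H)) = H`. -/
theorem stmt19 {X : Type u} [TopologicalSpace X] [PathConnectedSpace X] (x₀ : X)
    (H : Subgroup (FundamentalGroup X x₀))
    (hgraph : ∀ α : PS X x₀, IsClosed {q : X × I | α.1 q.2 = q.1})
    (htpd : TotallyPathDisconnected (Quot (fun α β :
        {f : C(I, X) // f 0 = x₀ ∧ f 1 = x₀} =>
      loopCls ((⟨α.1, α.2.1, α.2.2⟩ : Path x₀ x₀).trans
        (⟨β.1, β.2.1, β.2.2⟩ : Path x₀ x₀).symm) ∈ H))) :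
    ContPathCovering (pH x₀ H) ∧
    ∀ α : Path x₀ x₀, (loopCls α ∈ H ↔
      ∃ γ : Path (baseptH x₀ H) (baseptH x₀ H),
        (γ.map (pH x₀ H).continuous).Homotopic α) :=
  ⟨contPathCovering_pH hgraph htpd, loopCls_mem_iff_exists_loop hgraph htpd⟩
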